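/- Let w_l < w_r < 0, w̃ = w_r − w_l, and let ŵ be the characteristic solution of the Burgers equation with initial data w₀(x) = (w_r + w_l)/2 + (w̃/2)·tanh x. Then for all t ≥ 0 and all x ≥ 0: |ŵ(t,x) − w_r| ≤ w̃·exp(−2(|x| + |w_r|·t)) and |∂_x ŵ(t,x)| ≤ 2 w̃·exp(−2(|x| + |w_r|·t)). -/

import Mathlib

open Real

/-- Burgers initial data `w₀(x) = (w_r+w_l)/2 + ((w_r-w_l)/2)·tanh x`. -/
noncomputable def w0 (wl wr x : ℝ) : ℝ :=
  (wr + wl) / 2 + ((wr - wl) / 2) * Real.tanh x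

open Classical in
/-- The characteristic solution of Burgers' equation with initial data `w0 wl wr`:
`ŵ(t,x) = w₀(y(t,x))` where `y(t,x)` is the (unique, for `t ≥ 0`) root of
`y + t·w₀(y) = x`. -/
noncomputable def burgersSol (wl wr t x : ℝ) : ℝ :=
  if h : ∃ y : ℝ, y + t * w0 wl wr y = x then w0 wl wr h.choose else 0

theorem one_sub_tanh_le (y : ℝ) : 1 - Real.tanh y ≤ 2 * Real.exp (-2 * y) := by
  have h : Real.exp (-2 * y) * Real.exp y = Real.exp (-y) := by
    rw [← Real.exp_add]; ring_nf
  rw [Real.tanh_eq, one_sub_div (by positivity), div_le_iff₀ (by positivity)]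
  have := mul_pos (Real.exp_pos (-2 * y)) (Real.exp_pos (-y))
  linarith

theorem hasDerivAt_tanh (y : ℝ) : HasDerivAt Real.tanh (1 - Real.tanh y ^ 2) y := by
  have hc : Real.cosh y ≠ 0 := (Real.cosh_pos y).ne'
  have h := (Real.hasDerivAt_sinh y).div (Real.hasDerivAt_cosh y) hc
  have hfun : Real.sinh / Real.cosh = Real.tanh :=
    funext fun z => (Real.tanh_eq_sinh_div_cosh z).symm
  rw [hfun] at h
  have hval : 1 - Real.tanh y ^ 2 =
      (Real.cosh y * Real.cosh y - Real.sinh y * Real.sinh y) / Real.cosh y ^ 2 := by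
    rw [Real.tanh_eq_sinh_div_cosh]
    field_simp
  rwa [hval]

theorem hasDerivAt_w0 (wl wr y : ℝ) :
    HasDerivAt (w0 wl wr) ((wr - wl) / 2 * (1 - Real.tanh y ^ 2)) y :=
  ((hasDerivAt_tanh y).const_mul _).const_add _

theorem w0_lt {wl wr : ℝ} (hlt : wl < wr) (y : ℝ) : w0 wl wr y < wr := by
  have := mul_pos (sub_pos.2 hlt) (sub_pos.2 (Real.tanh_lt_one y))
  unfold w0
  linarith

theorem lt_w0 {wl wr : ℝ} (hlt : wl < wr) (y : ℝ) : wl < w0 wl wr y := by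
  have := mul_pos (sub_pos.2 hlt) (sub_pos.2 (Real.neg_one_lt_tanh y))
  unfold w0
  linarith

theorem exists_characteristic_foot {wl wr t : ℝ} (hlt : wl < wr) (ht : 0 ≤ t) (x : ℝ) :
    ∃ y : ℝ, y + t * w0 wl wr y = x := by
  have hcont : Continuous fun y => y + t * w0 wl wr y :=
    continuous_id.add (continuous_const.mul
      (continuous_iff_continuousAt.2 fun y => (hasDerivAt_w0 wl wr y).continuousAt))
  have hle : x - t * wr ≤ x - t * wl := by gcongr
  obtain ⟨y, -, hy⟩ := intermediate_value_Icc hle hcont.continuousOn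
    (show x ∈ _ from
      ⟨by linarith [mul_le_mul_of_nonneg_left (w0_lt hlt (x - t * wr)).le ht],
       by linarith [mul_le_mul_of_nonneg_left (lt_w0 hlt (x - t * wl)).le ht]⟩)
  exact ⟨y, hy⟩

/-- The characteristic solution satisfies the implicit equation `u = w₀(x - t u)`. -/
theorem burgersSol_eq_w0 {wl wr t : ℝ} (hlt : wl < wr) (ht : 0 ≤ t) (x : ℝ) :
    burgersSol wl wr t x = w0 wl wr (x - t * burgersSol wl wr t x) := by
  have h := exists_characteristic_foot hlt ht x
  have hu : burgersSol wl wr t x = w0 wl wr h.choose := dif_pos h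
  have hy : x - t * burgersSol wl wr t x = h.choose := by
    rw [hu]
    linarith [h.choose_spec]
  rw [hy, hu]

theorem abs_deriv_burgersSol_le {wl wr t : ℝ} (hlt : wl < wr) (ht : 0 ≤ t) (x : ℝ) :
    |deriv (burgersSol wl wr t) x| ≤
      (wr - wl) / 2 * (1 - Real.tanh (x - t * burgersSol wl wr t x) ^ 2) := by
  set y := x - t * burgersSol wl wr t x
  set m := (wr - wl) / 2 * (1 - Real.tanh y ^ 2)
  have hm0 : 0 ≤ m :=
    mul_nonneg (by linarith)
      (by nlinarith [Real.tanh_lt_one y, Real.neg_one_lt_tanh y])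
  by_cases hd : DifferentiableAt ℝ (burgersSol wl wr t) x
  · set d := deriv (burgersSol wl wr t) x
    have hu : HasDerivAt (burgersSol wl wr t) d x := hd.hasDerivAt
    have hcomp : HasDerivAt (burgersSol wl wr t) (m * (1 - t * d)) x := by
      have h := (hasDerivAt_w0 wl wr y).comp x ((hasDerivAt_id x).sub (hu.const_mul t))
      exact h.congr_of_eventuallyEq
        (Filter.Eventually.of_forall fun ξ => burgersSol_eq_w0 hlt ht ξ)
    have heq : d = m * (1 - t * d) := hu.unique hcomp
    have htm : 0 ≤ t * m := mul_nonneg ht hm0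
    have hd0 : 0 ≤ d := by
      by_contra! hneg
      nlinarith
    rw [abs_of_nonneg hd0]
    nlinarith
  · rwa [deriv_zero_of_not_differentiableAt hd, abs_zero]

/-- For `w_l < w_r < 0` and `w̃ = w_r - w_l`, the characteristic Burgers solution
satisfies, for all `t ≥ 0` and `x ≥ 0`,
`|ŵ(t,x) - w_r| ≤ w̃ e^{-2(|x| + |w_r| t)}` and `|∂_x ŵ(t,x)| ≤ 2 w̃ e^{-2(|x| + |w_r| t)}`. -/
theorem stmt8 (wl wr : ℝ) (hlt : wl < wr) (hneg : wr < 0) :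
    ∀ t : ℝ, 0 ≤ t → ∀ x : ℝ, 0 ≤ x →
      |burgersSol wl wr t x - wr| ≤ (wr - wl) * Real.exp (-2 * (|x| + |wr| * t)) ∧
      |deriv (fun ξ => burgersSol wl wr t ξ) x|
        ≤ 2 * (wr - wl) * Real.exp (-2 * (|x| + |wr| * t)) := by
  intro t ht x hx
  set y := x - t * burgersSol wl wr t x with hy
  have hu : burgersSol wl wr t x = w0 wl wr y := burgersSol_eq_w0 hlt ht x
  have hyge : x - wr * t ≤ y := by
    have := mul_le_mul_of_nonneg_left (w0_lt hlt y).le ht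
    rw [← hu] at this
    linarith
  have hexp : Real.exp (-2 * y) ≤ Real.exp (-2 * (|x| + |wr| * t)) := by
    rw [abs_of_nonneg hx, abs_of_neg hneg]
    exact Real.exp_le_exp.2 (by linarith)
  have htanh : 1 - Real.tanh y ≤ 2 * Real.exp (-2 * (|x| + |wr| * t)) :=
    (one_sub_tanh_le y).trans (by linarith)
  have hw : 0 < wr - wl := sub_pos.2 hlt
  constructor
  · rw [hu, abs_sub_comm, abs_of_pos (sub_pos.2 (w0_lt hlt y))]
    have := mul_le_mul_of_nonneg_left htanh hw.le
    unfold w0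
    linarith
  · refine (abs_deriv_burgersSol_le hlt ht x).trans ?_
    rw [← hy]
    have hsq : 1 - Real.tanh y ^ 2 ≤ 2 * (1 - Real.tanh y) := by
      nlinarith [sq_nonneg (1 - Real.tanh y)]
    have := mul_le_mul_of_nonneg_left (hsq.trans (mul_le_mul_of_nonneg_left htanh zero_le_two)) hw.le
    linarith
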